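/- Let C be a set in a real vector space, I a finite index set, and A_i, B_i : C → ℝ with A_i(x) > 0 and B_i(x) > 0 for all x ∈ C and all i. If the pair (x*, t*) with x* ∈ C and t* ∈ (0,∞)^I minimizes the function (x,t) ↦ ∑_i ( t_i·B_i(x)² + 1/(4 t_i·A_i(x)²) ) over C × (0,∞)^I, then x* minimizes x ↦ ∑_i B_i(x)/A_i(x) over C. -/

import Mathlib

/-- The fraction transform dominates the fraction, by the inequality of arithmetic and
geometric means. -/
theorem div_le_fraction_transform {a t : ℝ} (b : ℝ) (ha : 0 < a) (ht : 0 < t) :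
    b / a ≤ t * b ^ 2 + 1 / (4 * t * a ^ 2) := by
  have h : t * b ^ 2 + 1 / (4 * t * a ^ 2) - b / a =
      (2 * t * a * b - 1) ^ 2 / (4 * t * a ^ 2) := by
    field_simp
    ring
  have h_nonneg : 0 ≤ (2 * t * a * b - 1) ^ 2 / (4 * t * a ^ 2) := by positivity
  linarith

/-- The fraction transform equals the fraction at `t = 1 / (2 * a * b)`. -/
theorem fraction_transform_eq_div {a b : ℝ} (ha : a ≠ 0) (hb : b ≠ 0) :
    1 / (2 * a * b) * b ^ 2 + 1 / (4 * (1 / (2 * a * b)) * a ^ 2) = b / a := by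
  field_simp
  norm_num

/-- If `(x*, t*)` minimizes the fraction-transformed objective, then `x*`
minimizes the sum of fractions. -/
theorem sfmin_of_transform_minimizer {V : Type*} [AddCommGroup V] [Module ℝ V]
    (C : Set V) (I : Type*) [Fintype I]
    (A B : I → V → ℝ)
    (hA : ∀ i, ∀ x ∈ C, 0 < A i x) (hB : ∀ i, ∀ x ∈ C, 0 < B i x)
    (xs : V) (hxs : xs ∈ C) (ts : I → ℝ) (hts : ∀ i, 0 < ts i)
    (hmin : ∀ x ∈ C, ∀ t : I → ℝ, (∀ i, 0 < t i) →
      ∑ i, (ts i * (B i xs) ^ 2 + 1 / (4 * ts i * (A i xs) ^ 2)) ≤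
        ∑ i, (t i * (B i x) ^ 2 + 1 / (4 * t i * (A i x) ^ 2))) :
    ∀ x ∈ C, ∑ i, B i xs / A i xs ≤ ∑ i, B i x / A i x := by
  intro x hx
  have ht : ∀ i, 0 < 1 / (2 * A i x * B i x) := fun i => by
    have := hA i x hx
    have := hB i x hx
    positivity
  calc ∑ i, B i xs / A i xs
      ≤ ∑ i, (ts i * (B i xs) ^ 2 + 1 / (4 * ts i * (A i xs) ^ 2)) :=
        Finset.sum_le_sum fun i _ => div_le_fraction_transform _ (hA i xs hxs) (hts i)
    _ ≤ _ := hmin x hx _ ht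
    _ = ∑ i, B i x / A i x :=
        Finset.sum_congr rfl fun i _ =>
          fraction_transform_eq_div (hA i x hx).ne' (hB i x hx).ne'
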